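/- arXiv:1612.01446 — 2 statements merged into one kernel-verified Lean document; each statement's English description precedes it below -/
import Mathlib

section
/- Let n ≥ 1 and let A ∈ SU(2). Then Aⁿ = −1 if and only if there exists a natural number k such that the trace of A equals 2·cos((2·k+1)·π/n). -/
open Matrix

namespace Matrix

/-- For a special unitary matrix the adjugate, being the inverse, is the conjugate transpose. -/
theorem adjugate_eq_conjTranspose_of_mem_specialUnitaryGroup {m : Type*} [Fintype m]
    [DecidableEq m] {A : Matrix m m ℂ} (hA : A ∈ specialUnitaryGroup m ℂ) :
    A.adjugate = Aᴴ := by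
  obtain ⟨hU, hdet⟩ := mem_specialUnitaryGroup_iff.mp hA
  have h : Aᴴ * A = 1 := mem_unitaryGroup_iff'.mp hU
  calc A.adjugate = Aᴴ * A * A.adjugate := by rw [h, one_mul]
    _ = Aᴴ := by rw [mul_assoc, mul_adjugate, hdet, one_smul, mul_one]

theorem apply_one_one_of_mem_specialUnitaryGroup {A : Matrix (Fin 2) (Fin 2) ℂ}
    (hA : A ∈ specialUnitaryGroup (Fin 2) ℂ) : A 1 1 = star (A 0 0) := by
  simpa [adjugate_fin_two] using
    congrFun₂ (adjugate_eq_conjTranspose_of_mem_specialUnitaryGroup hA) 0 0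

theorem apply_one_zero_of_mem_specialUnitaryGroup {A : Matrix (Fin 2) (Fin 2) ℂ}
    (hA : A ∈ specialUnitaryGroup (Fin 2) ℂ) : A 1 0 = -star (A 0 1) := by
  have h := congrFun₂ (adjugate_eq_conjTranspose_of_mem_specialUnitaryGroup hA) 1 0
  simp only [adjugate_fin_two, conjTranspose_apply] at h
  rw [← h]
  simp

theorem normSq_add_normSq_of_mem_specialUnitaryGroup {A : Matrix (Fin 2) (Fin 2) ℂ}
    (hA : A ∈ specialUnitaryGroup (Fin 2) ℂ) :
    Complex.normSq (A 0 0) + Complex.normSq (A 0 1) = 1 := by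
  have h := (mem_specialUnitaryGroup_iff.mp hA).2
  rw [det_fin_two, apply_one_one_of_mem_specialUnitaryGroup hA,
    apply_one_zero_of_mem_specialUnitaryGroup hA, mul_neg, sub_neg_eq_add] at h
  simp only [Complex.star_def, Complex.mul_conj] at h
  exact_mod_cast h

theorem trace_of_mem_specialUnitaryGroup_fin_two {A : Matrix (Fin 2) (Fin 2) ℂ}
    (hA : A ∈ specialUnitaryGroup (Fin 2) ℂ) : A.trace = ((2 * (A 0 0).re : ℝ) : ℂ) := by
  rw [trace_fin_two, apply_one_one_of_mem_specialUnitaryGroup hA, Complex.star_def,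
    Complex.add_conj]

theorem exists_trace_eq_two_mul_cos {A : Matrix (Fin 2) (Fin 2) ℂ}
    (hA : A ∈ specialUnitaryGroup (Fin 2) ℂ) :
    ∃ θ : ℝ, 0 ≤ θ ∧ A.trace = ((2 * Real.cos θ : ℝ) : ℂ) := by
  have h := normSq_add_normSq_of_mem_specialUnitaryGroup hA
  have hb := Complex.normSq_nonneg (A 0 1)
  rw [Complex.normSq_apply] at h
  refine ⟨Real.arccos (A 0 0).re, Real.arccos_nonneg _, ?_⟩
  rw [Real.cos_arccos (by nlinarith [mul_self_nonneg (A 0 0).im])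
    (by nlinarith [mul_self_nonneg (A 0 0).im]), trace_of_mem_specialUnitaryGroup_fin_two hA]

/-- An element of `SU(2)` with trace `±2` is scalar. -/
theorem eq_smul_one_of_sin_eq_zero {A : Matrix (Fin 2) (Fin 2) ℂ}
    (hA : A ∈ specialUnitaryGroup (Fin 2) ℂ) {θ : ℝ}
    (ht : A.trace = ((2 * Real.cos θ : ℝ) : ℂ)) (hθ : Real.sin θ = 0) :
    A = (Real.cos θ : ℂ) • (1 : Matrix (Fin 2) (Fin 2) ℂ) := by
  have h := normSq_add_normSq_of_mem_specialUnitaryGroup hA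
  rw [trace_of_mem_specialUnitaryGroup_fin_two hA, Complex.ofReal_inj] at ht
  have hre : (A 0 0).re = Real.cos θ := by linarith
  have hcos := Real.sin_sq_add_cos_sq θ
  have hb := Complex.normSq_nonneg (A 0 1)
  rw [Complex.normSq_apply (A 0 0), hre] at h
  have him : (A 0 0).im = 0 := by
    rw [← mul_self_eq_zero]
    nlinarith [mul_self_nonneg (A 0 0).im]
  have h01 : A 0 1 = 0 := by
    rw [← Complex.normSq_eq_zero]
    nlinarith [mul_self_nonneg (A 0 0).im]
  have h00 : A 0 0 = (Real.cos θ : ℂ) := Complex.ext hre (by rw [him, Complex.ofReal_im])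
  ext i j
  fin_cases i <;> fin_cases j <;>
    simp [apply_one_one_of_mem_specialUnitaryGroup hA,
      apply_one_zero_of_mem_specialUnitaryGroup hA, h00, h01, -Complex.ofReal_cos]

/-- The Cayley–Hamilton theorem for 2×2 matrices of determinant one. -/
theorem mul_self_eq_trace_smul_sub_one {R : Type*} [CommRing R] {A : Matrix (Fin 2) (Fin 2) R}
    (hdet : A.det = 1) : A * A = A.trace • A - 1 := by
  rw [det_fin_two] at hdet
  ext i j
  fin_cases i <;> fin_cases j <;> simp [mul_apply, Fin.sum_univ_two, trace_fin_two]
  · linear_combination -hdet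
  · ring
  · ring
  · linear_combination -hdet

/-- De Moivre's formula for 2×2 matrices of determinant one, multiplied by `sin θ`. -/
theorem sin_smul_pow {A : Matrix (Fin 2) (Fin 2) ℂ} (hdet : A.det = 1) {θ : ℂ}
    (ht : A.trace = 2 * Complex.cos θ) (n : ℕ) :
    Complex.sin θ • A ^ n = (Complex.sin θ * Complex.cos (n * θ)) • 1 +
      Complex.sin (n * θ) • (A - Complex.cos θ • 1) := by
  have hsq := ht ▸ mul_self_eq_trace_smul_sub_one hdet
  induction n with
  | zero => simp
  | succ n ih =>
    have hcos := Complex.sin_sq_add_cos_sq θ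
    rw [pow_succ, ← smul_mul_assoc, ih, Nat.cast_succ, add_mul (n : ℂ), one_mul,
      Complex.sin_add, Complex.cos_add, add_mul, smul_mul_assoc, smul_mul_assoc, sub_mul, hsq,
      smul_mul_assoc, one_mul]
    match_scalars
    · ring
    · linear_combination Complex.sin (n * θ) * hcos

theorem trace_pow_eq_two_mul_cos {A : Matrix (Fin 2) (Fin 2) ℂ} (hdet : A.det = 1) {θ : ℂ}
    (ht : A.trace = 2 * Complex.cos θ) (n : ℕ) :
    (A ^ n).trace = 2 * Complex.cos (n * θ) := by
  induction n using Nat.twoStepInduction with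
  | zero => simp
  | one => simpa using ht
  | more n ih₀ ih₁ =>
    have hpow : A ^ (n + 2) = (2 * Complex.cos θ) • A ^ (n + 1) - A ^ n := by
      rw [pow_add, pow_two, mul_self_eq_trace_smul_sub_one hdet, ht, mul_sub, mul_one,
        mul_smul_comm, pow_succ]
    have hcos := Complex.sin_sq_add_cos_sq θ
    rw [hpow, trace_sub, trace_smul, ih₀, ih₁, smul_eq_mul]
    have h₁ : ((n + 1 : ℕ) : ℂ) * θ = n * θ + θ := by push_cast; ring
    have h₂ : ((n + 2 : ℕ) : ℂ) * θ = n * θ + θ + θ := by push_cast; ring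
    simp only [h₁, h₂, Complex.cos_add, Complex.sin_add]
    linear_combination 2 * Complex.cos (n * θ) * hcos

end Matrix

/-- For `A ∈ SU(2)` and `n ≥ 1`, one has `Aⁿ = -1` iff the trace of `A`
equals `2·cos((2k+1)π/n)` for some natural number `k`. -/
theorem pow_eq_neg_one_iff_trace_SU2 (n : ℕ) (hn : 1 ≤ n)
    (A : Matrix (Fin 2) (Fin 2) ℂ)
    (hA : A ∈ Matrix.specialUnitaryGroup (Fin 2) ℂ) :
    A ^ n = -1 ↔
      ∃ k : ℕ, A.trace = ((2 * Real.cos ((2 * k + 1) * Real.pi / n) : ℝ) : ℂ) := by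
  have hdet := (mem_specialUnitaryGroup_iff.mp hA).2
  have hn0 : (n : ℝ) ≠ 0 := Nat.cast_ne_zero.mpr (Nat.one_le_iff_ne_zero.mp hn)
  constructor
  · intro hpow
    obtain ⟨θ, hθ, ht⟩ := exists_trace_eq_two_mul_cos hA
    have htr := trace_pow_eq_two_mul_cos hdet (θ := θ) (by simpa using ht) n
    have hcos : Real.cos (n * θ) = -1 := by
      rw [hpow, trace_neg, trace_one, Fintype.card_fin] at htr
      have : ((Real.cos (n * θ) : ℝ) : ℂ) = ((-1 : ℝ) : ℂ) := by
        push_cast at htr ⊢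
        linear_combination -htr / 2
      exact_mod_cast this
    obtain ⟨k, hk⟩ := Real.cos_eq_neg_one_iff.mp hcos
    have hk0 : 0 ≤ k := by
      have h : 0 ≤ (2 * (k : ℝ) + 1) * Real.pi := by
        rw [show (2 * (k : ℝ) + 1) * Real.pi = n * θ by rw [← hk]; ring]
        positivity
      have h' : (0 : ℝ) ≤ ((2 * k + 1 : ℤ) : ℝ) := by
        push_cast
        exact nonneg_of_mul_nonneg_left h Real.pi_pos
      have : 0 ≤ 2 * k + 1 := by exact_mod_cast h'
      lia
    lift k to ℕ using hk0
    refine ⟨k, ?_⟩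
    rw [ht, show (2 * (k : ℝ) + 1) * Real.pi / n = θ by
      rw [div_eq_iff hn0, mul_comm θ, ← hk]; push_cast; ring]
  · rintro ⟨k, ht⟩
    set θ : ℝ := (2 * k + 1) * Real.pi / n with hθ
    have hnθ : n * θ = Real.pi + (k : ℤ) * (2 * Real.pi) := by
      rw [hθ, mul_div_cancel₀ _ hn0]; push_cast; ring
    have hcos : Complex.cos (n * θ) = -1 := by
      exact_mod_cast Real.cos_eq_neg_one_iff.mpr ⟨k, hnθ.symm⟩
    have ht' : A.trace = 2 * Complex.cos θ := by simpa using ht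
    by_cases hs : Real.sin θ = 0
    · have htr := trace_pow_eq_two_mul_cos hdet ht' n
      rw [eq_smul_one_of_sin_eq_zero hA ht hs, smul_pow, one_pow] at htr ⊢
      rw [trace_smul, trace_one, Fintype.card_fin, hcos, smul_eq_mul] at htr
      have hc : (Real.cos θ : ℂ) ^ n = -1 := by
        push_cast at htr ⊢
        linear_combination htr / 2
      rw [hc, neg_one_smul]
    · have hsin : Complex.sin (n * θ) = 0 := by
        have := Complex.sin_sq_add_cos_sq (n * θ)
        rw [hcos] at this
        simpa using this
      have hs' : Complex.sin θ ≠ 0 := by exact_mod_cast hs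
      have h := sin_smul_pow hdet ht' n
      rw [hcos, hsin, zero_smul, add_zero, mul_smul, neg_one_smul] at h
      exact smul_right_injective _ hs' h
end

section
/- Let n ≥ 1 and let ε ∈ {1, −1} ⊆ SU(2). Then the set T = {t ∈ ℝ : ∃ A ∈ SU(2), Aⁿ = ε·1 and trace A = t} is finite, and the sum over t ∈ T of the weight w(t) — where w(t) = 1 if t = 2 or t = −2, and w(t) = 2 otherwise — equals n. -/
/-- A nonzero complex number has exactly `n` distinct `n`-th roots, for `n ≥ 1`. -/
lemma card_nthRootsFinset_of_ne_zero {n : ℕ} (hn : n ≠ 0) {c : ℂ} (hc : c ≠ 0) :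
    (Polynomial.nthRootsFinset n c).card = n := by
  have hsep : (Polynomial.X ^ n - Polynomial.C c).Separable :=
    Polynomial.separable_X_pow_sub_C c (by exact_mod_cast hn) hc
  rw [Polynomial.nthRootsFinset_def, Polynomial.nthRoots,
    Multiset.toFinset_card_of_nodup (Polynomial.nodup_roots hsep),
    ← (IsAlgClosed.splits _).natDegree_eq_card_roots, Polynomial.natDegree_X_pow_sub_C]

/-- A root of unity up to sign lies on the unit circle. -/
lemma re_sq_add_im_sq_of_pow_eq {n : ℕ} (hn : n ≠ 0) {c z : ℂ} (hc : c = 1 ∨ c = -1)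
    (hz : z ^ n = c) : z.re ^ 2 + z.im ^ 2 = 1 := by
  have hnorm : ‖z‖ = 1 := by
    rw [← pow_eq_one_iff_of_nonneg (norm_nonneg z) hn, ← norm_pow, hz]
    rcases hc with rfl | rfl <;> simp
  have := Complex.sq_norm z
  rw [hnorm, Complex.normSq_apply] at this
  linarith

/-- An element of `SL(2, ℂ)` whose `n`-th power is `c = ±1` has trace `2 Re z` for some `n`-th
root `z` of `c`. -/
lemma exists_pow_eq_and_trace_eq {n : ℕ} (hn : n ≠ 0) {c : ℂ} (hc : c = 1 ∨ c = -1)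
    {A : Matrix (Fin 2) (Fin 2) ℂ} (hdet : A.det = 1) (hA : A ^ n = algebraMap ℂ _ c) :
    ∃ z : ℂ, z ^ n = c ∧ A.trace = ((2 * z.re : ℝ) : ℂ) := by
  obtain ⟨z, hz⟩ := spectrum.nonempty_of_isAlgClosed_of_finiteDimensional ℂ A
  have hzn : z ^ n = c := by
    have := spectrum.pow_mem_pow A n hz
    rwa [hA, spectrum.scalar_eq, Set.mem_singleton_iff] at this
  refine ⟨z, hzn, ?_⟩
  have hcirc := re_sq_add_im_sq_of_pow_eq hn hc hzn
  have hconj : z * (starRingEnd ℂ) z = 1 := by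
    rw [Complex.mul_conj, Complex.normSq_apply]
    exact_mod_cast (by linarith : z.re * z.re + z.im * z.im = 1)
  have hz0 : z ≠ 0 := left_ne_zero_of_mul_eq_one hconj
  rw [spectrum.mem_iff, Matrix.isUnit_iff_isUnit_det, isUnit_iff_ne_zero, not_not,
    Matrix.det_fin_two] at hz
  rw [Matrix.det_fin_two] at hdet
  simp only [Matrix.sub_apply, Matrix.algebraMap_matrix_apply, Fin.isValue, if_true, zero_ne_one,
    one_ne_zero, if_false, Algebra.algebraMap_self, RingHom.id_apply, zero_sub] at hz
  rw [Matrix.trace_fin_two, ← Complex.add_conj]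
  apply mul_left_cancel₀ hz0
  linear_combination hdet - hz - hconj

/-- The diagonal matrix `diag(z, z̄)` with `|z| = 1` lies in `SU(2)`. -/
lemma diagonal_conj_mem_specialUnitaryGroup {z : ℂ} (hz : z.re ^ 2 + z.im ^ 2 = 1) :
    Matrix.diagonal ![z, (starRingEnd ℂ) z] ∈ Matrix.specialUnitaryGroup (Fin 2) ℂ := by
  have hconj : z * (starRingEnd ℂ) z = 1 := by
    rw [Complex.mul_conj, Complex.normSq_apply]
    exact_mod_cast (by linarith : z.re * z.re + z.im * z.im = 1)
  rw [Matrix.mem_specialUnitaryGroup_iff, Matrix.mem_unitaryGroup_iff]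
  refine ⟨?_, by simp [Matrix.det_diagonal, hconj]⟩
  rw [Matrix.star_eq_conjTranspose, Matrix.diagonal_conjTranspose, Matrix.diagonal_mul_diagonal,
    ← Matrix.diagonal_one]
  congr 1
  funext i
  fin_cases i
  · simpa using hconj
  · simpa [mul_comm] using hconj

/-- The traces of the solutions of `Aⁿ = c = ±1` in `SU(2)` are the numbers `2 Re z`, `zⁿ = c`. -/
lemma setOf_trace_eq_image {n : ℕ} (hn : n ≠ 0) {c : ℂ} (hc : c = 1 ∨ c = -1) :
    {t : ℝ | ∃ A ∈ Matrix.specialUnitaryGroup (Fin 2) ℂ,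
        A ^ n = algebraMap ℂ _ c ∧ A.trace = (t : ℂ)} =
      ((Polynomial.nthRootsFinset n c).image fun z => 2 * z.re : Finset ℝ) := by
  have hpos := Nat.pos_of_ne_zero hn
  ext t
  simp only [Set.mem_ofPred_eq, Finset.coe_image, Set.mem_image, Finset.mem_coe,
    Polynomial.mem_nthRootsFinset hpos]
  constructor
  · rintro ⟨A, hA, hAn, htr⟩
    obtain ⟨z, hz, hzt⟩ :=
      exists_pow_eq_and_trace_eq hn hc (Matrix.mem_specialUnitaryGroup_iff.1 hA).2 hAn
    exact ⟨z, hz, by exact_mod_cast hzt.symm.trans htr⟩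
  · rintro ⟨z, hz, rfl⟩
    refine ⟨_, diagonal_conj_mem_specialUnitaryGroup (re_sq_add_im_sq_of_pow_eq hn hc hz), ?_, ?_⟩
    · rw [Matrix.diagonal_pow, Matrix.algebraMap_eq_diagonal]
      congr 1
      funext i
      fin_cases i
      · simpa using hz
      · rcases hc with rfl | rfl <;> simp [← map_pow, hz]
    · rw [Matrix.trace_diagonal, Fin.sum_univ_two, ← Complex.add_conj]
      simp

/-- Among the `n`-th roots of `c = ±1`, those with the same real part as `z` are `z` and `z̄`. -/
lemma filter_two_mul_re_eq {n : ℕ} (hn : n ≠ 0) {c z : ℂ} (hc : c = 1 ∨ c = -1)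
    (hz : z ^ n = c) :
    (Polynomial.nthRootsFinset n c).filter (fun w => 2 * w.re = 2 * z.re) =
      {z, (starRingEnd ℂ) z} := by
  have hpos := Nat.pos_of_ne_zero hn
  ext w
  simp only [Finset.mem_filter, Polynomial.mem_nthRootsFinset hpos, Finset.mem_insert,
    Finset.mem_singleton]
  constructor
  · rintro ⟨hw, hre⟩
    have hre' : w.re = z.re := by linarith
    have hwc := re_sq_add_im_sq_of_pow_eq hn hc hw
    have hzc := re_sq_add_im_sq_of_pow_eq hn hc hz
    rw [hre'] at hwc
    rcases sq_eq_sq_iff_eq_or_eq_neg.1 (by linarith : w.im ^ 2 = z.im ^ 2) with h | h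
    · exact Or.inl (Complex.ext hre' h)
    · exact Or.inr (Complex.ext (by simpa using hre') (by simpa using h))
  · rintro (rfl | rfl)
    · exact ⟨hz, rfl⟩
    · refine ⟨?_, by simp⟩
      rcases hc with rfl | rfl <;> simp [← map_pow, hz]

/-- On the unit circle, `{z, z̄}` has one element if `2 Re z = ±2` and two otherwise. -/
lemma card_pair_conj {z : ℂ} (hz : z.re ^ 2 + z.im ^ 2 = 1) :
    ({z, (starRingEnd ℂ) z} : Finset ℂ).card =
      if 2 * z.re = 2 ∨ 2 * z.re = -2 then 1 else 2 := by
  split_ifs with h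
  · have him : z.im = 0 := by
      rcases h with h | h
      · have : z.re = 1 := by linarith
        simpa [this] using hz
      · have : z.re = -1 := by linarith
        simpa [this] using hz
    rw [Complex.conj_eq_iff_im.2 him, Finset.pair_eq_singleton, Finset.card_singleton]
  · refine Finset.card_pair fun heq => h ?_
    rw [Complex.conj_eq_iff_im.1 heq.symm] at hz
    rcases sq_eq_one_iff.1 (by linarith : z.re ^ 2 = 1) with h1 | h1
    · exact Or.inl (by linarith)
    · exact Or.inr (by linarith)

/-- For `n ≥ 1` and `ε = ±1` in `SU(2)`, the set of traces of solutions of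
`Aⁿ = ε` in `SU(2)` is finite, and counting each trace with weight `1` if it is
`±2` (central conjugacy classes) and `2` otherwise (spherical conjugacy classes)
gives a total of exactly `n`. -/
theorem weighted_trace_count_of_torsion_SU2 (n : ℕ) (hn : 1 ≤ n)
    (ε : Matrix (Fin 2) (Fin 2) ℂ) (hε : ε = 1 ∨ ε = -1) :
    ∃ hT : ({t : ℝ | ∃ A ∈ Matrix.specialUnitaryGroup (Fin 2) ℂ,
        A ^ n = ε ∧ A.trace = (t : ℂ)} : Set ℝ).Finite,
      (∑ t ∈ hT.toFinset, if t = 2 ∨ t = -2 then 1 else 2) = n := by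
  have hn0 : n ≠ 0 := Nat.one_le_iff_ne_zero.1 hn
  obtain ⟨c, hc, rfl⟩ : ∃ c : ℂ, (c = 1 ∨ c = -1) ∧ ε = algebraMap ℂ _ c := by
    rcases hε with rfl | rfl
    · exact ⟨1, Or.inl rfl, by simp⟩
    · exact ⟨-1, Or.inr rfl, by simp⟩
  have hc0 : c ≠ 0 := by rcases hc with rfl | rfl <;> simp
  rw [setOf_trace_eq_image hn0 hc]
  refine ⟨Finset.finite_toSet _, ?_⟩
  rw [Finset.finite_toSet_toFinset]
  conv_rhs => rw [← card_nthRootsFinset_of_ne_zero hn0 hc0]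
  rw [Finset.card_eq_sum_card_image (fun z : ℂ => 2 * z.re)]
  refine Finset.sum_congr rfl fun t ht => ?_
  obtain ⟨z, hz, rfl⟩ := Finset.mem_image.1 ht
  rw [Polynomial.mem_nthRootsFinset (Nat.pos_of_ne_zero hn0)] at hz
  rw [filter_two_mul_re_eq hn0 hc hz, card_pair_conj (re_sq_add_im_sq_of_pow_eq hn0 hc hz)]
end
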